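/- (Potentiality.) Let U ⊆ ℂ^μ be a convex open set and let B_{abc} : U → ℂ (for 1 ≤ a,b,c ≤ μ) be holomorphic functions that are symmetric under all permutations of the indices a,b,c and satisfy ∂_e B_{abc} = ∂_a B_{ebc} on U for all indices a,b,c,e (where ∂_a denotes the complex partial derivative in the a-th coordinate). Then there exists a holomorphic function F₀ : U → ℂ such that B_{abc} = ∂_a∂_b∂_c F₀ on U for all a,b,c. -/

import Mathlib

/-- The complex partial derivative `∂_a F` of `F : ℂ^μ → ℂ` in the `a`-th coordinate. -/
noncomputable def cpderiv {μ : ℕ} (a : Fin μ) (F : (Fin μ → ℂ) → ℂ) :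
    (Fin μ → ℂ) → ℂ :=
  fun x => fderiv ℂ F x (Pi.single a 1)

theorem cpderiv_congr_of_eqOn {μ : ℕ} {U : Set (Fin μ → ℂ)} (hU : IsOpen U)
    {F G : (Fin μ → ℂ) → ℂ} (h : Set.EqOn F G U) (a : Fin μ) :
    Set.EqOn (cpderiv a F) (cpderiv a G) U := fun x hx => by
  unfold cpderiv
  rw [(h.eventuallyEq_of_mem (hU.mem_nhds hx)).fderiv_eq]

/-- **Poincaré lemma** for holomorphic `1`-forms on a convex open subset of `ℂ^μ`, in
coordinates. -/
theorem exists_potential_of_cpderiv_comm {μ : ℕ} {U : Set (Fin μ → ℂ)}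
    (hU : IsOpen U) (hconv : Convex ℝ U) {f : Fin μ → (Fin μ → ℂ) → ℂ}
    (hf : ∀ a, DifferentiableOn ℂ (f a) U)
    (hcurl : ∀ a b, Set.EqOn (cpderiv a (f b)) (cpderiv b (f a)) U) :
    ∃ F : (Fin μ → ℂ) → ℂ, DifferentiableOn ℂ F U ∧ ∀ a, Set.EqOn (cpderiv a F) (f a) U := by
  let p (a : Fin μ) : (Fin μ → ℂ) →L[ℂ] ℂ := ContinuousLinearMap.proj a
  have hω : ∀ x ∈ U, HasFDerivAt (fun y => ∑ a, f a y • p a)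
      (∑ a, (fderiv ℂ (f a) x).smulRight (p a)) x := fun x hx =>
    HasFDerivAt.fun_sum fun a _ =>
      ((hf a).differentiableAt (hU.mem_nhds hx)).hasFDerivAt.smul_const (p a)
  have hexpand : ∀ (L : (Fin μ → ℂ) →L[ℂ] ℂ) v, L v = ∑ a, v a * L (Pi.single a 1) :=
    fun L v => by
      conv_lhs => rw [pi_eq_sum_univ' v]
      simp [map_sum]
  obtain ⟨F, hF⟩ := hconv.exists_forall_hasFDerivWithinAt_of_hasFDerivWithinAt_symmetric
    (fun x hx => ((hω x hx).restrictScalars ℝ).hasFDerivWithinAt (s := U)) (by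
      intro x hx v _ w _
      simp only [ContinuousLinearMap.coe_restrictScalars', sum_apply,
        ContinuousLinearMap.smulRight_apply, smul_apply, smul_eq_mul, p,
        ContinuousLinearMap.proj_apply]
      simp_rw [hexpand _ v, hexpand _ w, Finset.sum_mul]
      rw [Finset.sum_comm]
      refine Finset.sum_congr rfl fun a _ => Finset.sum_congr rfl fun b _ => ?_
      have h := hcurl a b hx
      unfold cpderiv at h
      rw [h]
      ring)
  have hF' : ∀ x ∈ U, HasFDerivAt F (∑ a, f a x • p a) x := fun x hx =>
    (hF x hx).hasFDerivAt (hU.mem_nhds hx)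
  refine ⟨F, fun x hx => (hF' x hx).differentiableAt.differentiableWithinAt, fun a x hx => ?_⟩
  simp [cpderiv, (hF' x hx).fderiv, p, Pi.single_apply]

/-- **Potentiality.**  Let `U ⊆ ℂ^μ` be convex open and let `B_{abc} : U → ℂ` be
holomorphic, totally symmetric in `a,b,c`, and curl-free: `∂_e B_{abc} = ∂_a B_{ebc}`
on `U`.  Then there is a holomorphic potential `F₀ : U → ℂ` with
`B_{abc} = ∂_a∂_b∂_c F₀` on `U`. -/
theorem frobenius_potentiality (μ : ℕ) (U : Set (Fin μ → ℂ))
    (hU : IsOpen U) (hconv : Convex ℝ U)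
    (B : Fin μ → Fin μ → Fin μ → (Fin μ → ℂ) → ℂ)
    (hhol : ∀ a b c, DifferentiableOn ℂ (B a b c) U)
    (hsym1 : ∀ a b c, B a b c = B b a c)
    (hsym2 : ∀ a b c, B a b c = B a c b)
    (hcurl : ∀ a b c e, ∀ x ∈ U, cpderiv e (B a b c) x = cpderiv a (B e b c) x) :
    ∃ F₀ : (Fin μ → ℂ) → ℂ, DifferentiableOn ℂ F₀ U ∧
      ∀ a b c, ∀ x ∈ U, B a b c x = cpderiv a (cpderiv b (cpderiv c F₀)) x := by
  have hC : ∀ b c, ∃ C : (Fin μ → ℂ) → ℂ, DifferentiableOn ℂ C U ∧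
      ∀ a, Set.EqOn (cpderiv a C) (B a b c) U := fun b c =>
    exists_potential_of_cpderiv_comm hU hconv (fun a => hhol a b c)
      fun e a x hx => hcurl a b c e x hx
  choose C hCd hCp using hC
  have hsymm : ∀ a b c, B a (min b c) (max b c) = B a b c := fun a b c => by
    rcases le_total b c with h | h
    · simp [h]
    · simpa [h] using hsym2 a c b
  have hD : ∀ c, ∃ D : (Fin μ → ℂ) → ℂ, DifferentiableOn ℂ D U ∧
      ∀ b, Set.EqOn (cpderiv b D) (C (min b c) (max b c)) U := fun c =>
    exists_potential_of_cpderiv_comm hU hconv (fun b => hCd _ _) fun a b x hx => by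
      rw [hCp _ _ a hx, hCp _ _ b hx, hsymm, hsymm, hsym1]
  choose D hDd hDp using hD
  obtain ⟨F, hFd, hFp⟩ := exists_potential_of_cpderiv_comm hU hconv hDd fun b c x hx => by
    rw [hDp _ _ hx, hDp _ _ hx, min_comm, max_comm]
  refine ⟨F, hFd, fun a b c x hx => ?_⟩
  have hbc := (cpderiv_congr_of_eqOn hU (hFp c) b).trans (hDp c b)
  rw [cpderiv_congr_of_eqOn hU hbc a hx, hCp _ _ a hx, hsymm]
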